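/- arXiv:2109.06294 — 2 statements merged into one kernel-verified Lean document; each statement's English description precedes it below -/
import Mathlib

section
/- Let N be a norm on ℝ^d with dual norm N_*, let μ₀ be a Borel probability measure on ℝ^d with bounded support, and let j : ℝ^d × Θ → ℝ be such that for every θ ∈ Θ the map x ↦ j(x,θ) is twice continuously differentiable with operator norm of the Hessian D²_x j(x,θ) bounded by a constant C uniformly over all x ∈ ℝ^d and θ ∈ Θ. For δ > 0 let F^∞_{μ₀,δ} be the set of Borel probability measures π on ℝ^d × ℝ^d whose first marginal is μ₀ and such that N(x̃ − x) ≤ δ for π-almost every (x,x̃). Then there exists a constant C′, depending only on C, d and N, such that for every θ ∈ Θ and every δ > 0: | sup_{π ∈ F^∞_{μ₀,δ}} ∫ j(x̃,θ) dπ(x,x̃) − ∫ j(x,θ) dμ₀(x) − δ ∫ N_*(∇_x j(x,θ)) dμ₀(x) | ≤ C′ δ². -/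
open MeasureTheory Real
open scoped RealInnerProductSpace

section DualNorm

variable {E : Type*} [NormedAddCommGroup E]

lemma nonneg_of_homogeneous_of_subadditive [NormedSpace ℝ E] {N : E → ℝ}
    (hNsmul : ∀ (a : ℝ) (x : E), N (a • x) = |a| * N x)
    (hNadd : ∀ x y, N (x + y) ≤ N x + N y) (x : E) : 0 ≤ N x := by
  have h0 : N 0 = 0 := by simpa using hNsmul 0 0
  have hneg : N (-x) = N x := by simpa using hNsmul (-1) x
  have h := hNadd x (-x)
  rw [add_neg_cancel, h0, hneg] at h
  linarith

lemma continuous_of_homogeneous_of_subadditive [NormedSpace ℝ E] [FiniteDimensional ℝ E]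
    {N : E → ℝ}
    (hNsmul : ∀ (a : ℝ) (x : E), N (a • x) = |a| * N x)
    (hNadd : ∀ x y, N (x + y) ≤ N x + N y) : Continuous N := by
  have hconv : ConvexOn ℝ Set.univ N := by
    refine ⟨convex_univ, fun x _ y _ a b ha hb _ => ?_⟩
    calc N (a • x + b • y) ≤ N (a • x) + N (b • y) := hNadd _ _
      _ = a • N x + b • N y := by
        rw [hNsmul, hNsmul, abs_of_nonneg ha, abs_of_nonneg hb, smul_eq_mul, smul_eq_mul]
  exact hconv.locallyLipschitz.continuous

/-- On a finite-dimensional space every norm `N` dominates a multiple of the ambient norm. -/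
lemma exists_norm_le_mul_of_isNorm [NormedSpace ℝ E] [FiniteDimensional ℝ E] {N : E → ℝ}
    (hN0 : ∀ x, N x = 0 ↔ x = 0)
    (hNsmul : ∀ (a : ℝ) (x : E), N (a • x) = |a| * N x)
    (hNadd : ∀ x y, N (x + y) ≤ N x + N y) :
    ∃ B : ℝ, 0 < B ∧ ∀ x, ‖x‖ ≤ B * N x := by
  have hpos := nonneg_of_homogeneous_of_subadditive hNsmul hNadd
  have hcont := continuous_of_homogeneous_of_subadditive hNsmul hNadd
  rcases subsingleton_or_nontrivial E with hE | hE
  · exact ⟨1, one_pos, fun x => by simp [Subsingleton.elim x 0, (hN0 0).2 rfl]⟩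
  obtain ⟨m, hm, hmin⟩ := (isCompact_sphere (0 : E) 1).exists_isMinOn
    (NormedSpace.sphere_nonempty.2 zero_le_one) hcont.continuousOn
  have hm0 : 0 < N m := by
    refine lt_of_le_of_ne (hpos m) fun h => ?_
    have : m = 0 := (hN0 m).1 h.symm
    simp [this] at hm
  refine ⟨(N m)⁻¹, inv_pos.2 hm0, fun x => ?_⟩
  rcases eq_or_ne x 0 with rfl | hx
  · simp [(hN0 0).2 rfl]
  have hx0 : 0 < ‖x‖ := norm_pos_iff.2 hx
  have hle : N m ≤ N (‖x‖⁻¹ • x) := hmin (by simp [norm_smul, hx0.ne'])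
  rw [hNsmul, abs_of_pos (inv_pos.2 hx0), le_inv_mul_iff₀ hx0] at hle
  rw [le_inv_mul_iff₀ hm0]
  linarith

variable [InnerProductSpace ℝ E] {N Nstar : E → ℝ} {B : ℝ}

lemma bddAbove_inner_unitBall (hB : 0 < B) (hNB : ∀ x, ‖x‖ ≤ B * N x) (y : E) :
    BddAbove {r : ℝ | ∃ x, N x ≤ 1 ∧ r = ⟪y, x⟫} := by
  refine ⟨‖y‖ * B, ?_⟩
  rintro r ⟨x, hx, rfl⟩
  have hxB : ‖x‖ ≤ B := (hNB x).trans (by nlinarith)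
  exact (real_inner_le_norm y x).trans (mul_le_mul_of_nonneg_left hxB (norm_nonneg y))

lemma inner_le_mul_dualNorm (hB : 0 < B) (hNB : ∀ x, ‖x‖ ≤ B * N x)
    (hNsmul : ∀ (a : ℝ) (x : E), N (a • x) = |a| * N x)
    (hNstar : ∀ y, Nstar y = sSup {r : ℝ | ∃ x, N x ≤ 1 ∧ r = ⟪y, x⟫})
    {δ : ℝ} (hδ : 0 < δ) (y : E) {v : E} (hv : N v ≤ δ) : ⟪y, v⟫ ≤ δ * Nstar y := by
  have h : ⟪y, δ⁻¹ • v⟫ ≤ Nstar y := by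
    rw [hNstar]
    refine le_csSup (bddAbove_inner_unitBall hB hNB y) ⟨δ⁻¹ • v, ?_, rfl⟩
    rw [hNsmul, abs_of_pos (inv_pos.2 hδ), inv_mul_le_iff₀ hδ]
    linarith
  rwa [real_inner_smul_right, inv_mul_le_iff₀ hδ] at h

lemma continuous_dualNorm (hB : 0 < B) (hNB : ∀ x, ‖x‖ ≤ B * N x) (hN0 : N 0 = 0)
    (hNstar : ∀ y, Nstar y = sSup {r : ℝ | ∃ x, N x ≤ 1 ∧ r = ⟪y, x⟫}) :
    Continuous Nstar := by
  refine (LipschitzWith.of_le_add_mul' B fun y z => ?_).continuous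
  rw [hNstar y]
  refine csSup_le ⟨_, 0, by simp [hN0], rfl⟩ ?_
  rintro r ⟨x, hx, rfl⟩
  have h1 : ⟪z, x⟫ ≤ Nstar z := by
    rw [hNstar]
    exact le_csSup (bddAbove_inner_unitBall hB hNB z) ⟨x, hx, rfl⟩
  have hxB : ‖x‖ ≤ B := (hNB x).trans (by nlinarith)
  have h2 : ⟪y - z, x⟫ ≤ B * dist y z := by
    rw [dist_eq_norm, mul_comm]
    exact (real_inner_le_norm _ x).trans (mul_le_mul_of_nonneg_left hxB (norm_nonneg _))
  rw [inner_sub_left] at h2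
  linarith

/-- Up to a positive error, the supremum defining the dual norm is attained at a point
of the unit ball that depends measurably on the dual variable. -/
lemma exists_measurable_dualNorm_sub_le_inner [FiniteDimensional ℝ E] [MeasurableSpace E]
    [BorelSpace E] (hN0 : N 0 = 0) (hNstarc : Continuous Nstar)
    (hNstar : ∀ y, Nstar y = sSup {r : ℝ | ∃ x, N x ≤ 1 ∧ r = ⟪y, x⟫})
    {ε : ℝ} (hε : 0 < ε) :
    ∃ T : E → E, Measurable T ∧ ∀ y, N (T y) ≤ 1 ∧ Nstar y - ε ≤ ⟪y, T y⟫ := by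
  classical
  have : ProperSpace E := FiniteDimensional.proper_real E
  have : Nonempty {x : E // N x ≤ 1} := ⟨⟨0, by simp [hN0]⟩⟩
  let v := TopologicalSpace.denseSeq {x : E // N x ≤ 1}
  have hex : ∀ y, ∃ n, Nstar y - ε < ⟪y, (v n : E)⟫ := by
    intro y
    obtain ⟨r, ⟨x, hx, rfl⟩, hr⟩ := exists_lt_of_lt_csSup
      (s := {r : ℝ | ∃ x, N x ≤ 1 ∧ r = ⟪y, x⟫}) ⟨_, 0, by simp [hN0], rfl⟩
      (b := Nstar y - ε) (by rw [← hNstar]; linarith)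
    have ho : IsOpen {x : {x : E // N x ≤ 1} | Nstar y - ε < ⟪y, (x : E)⟫} :=
      isOpen_lt continuous_const (by fun_prop)
    exact (TopologicalSpace.denseRange_denseSeq _).exists_mem_open ho ⟨⟨x, hx⟩, hr⟩
  refine ⟨fun y => v (Nat.find (hex y)), ?_, fun y => ⟨(v _).2, (Nat.find_spec (hex y)).le⟩⟩
  refine Measurable.find (f := fun n _ => (v n : E)) (fun _ => measurable_const) (fun n => ?_) hex
  exact measurableSet_lt (hNstarc.measurable.sub_const ε)
    (by fun_prop : Continuous fun y : E => ⟪y, (v n : E)⟫).measurable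

end DualNorm

section Taylor

variable {E : Type*} [NormedAddCommGroup E] {f : E → ℝ} {C : ℝ}

lemma abs_sub_sub_fderiv_le_of_norm_iteratedFDeriv_two_le [NormedSpace ℝ E] (hf : ContDiff ℝ 2 f)
    (hC : ∀ x, ‖iteratedFDeriv ℝ 2 f x‖ ≤ C) (x y : E) :
    |f y - f x - fderiv ℝ f x (y - x)| ≤ C * ‖y - x‖ ^ 2 := by
  have hC0 : 0 ≤ C := (norm_nonneg _).trans (hC x)
  have hf' : Differentiable ℝ (fderiv ℝ f) :=
    (hf.fderiv_right (m := 1) (by norm_num)).differentiable (by norm_num)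
  have hb : ∀ z, ‖fderiv ℝ (fderiv ℝ f) z‖ ≤ C := fun z => by
    rw [← norm_iteratedFDeriv_one, norm_iteratedFDeriv_fderiv]
    exact hC z
  have h := (convex_closedBall x ‖y - x‖).norm_image_sub_le_of_norm_fderiv_le'
    (𝕜 := ℝ) (f := f) (φ := fderiv ℝ f x) (C := C * ‖y - x‖) (x := x) (y := y)
    (fun z _ => hf.differentiable (by norm_num) z) (fun z hz => ?_)
    (by simp) (by simp [dist_eq_norm])
  · rw [Real.norm_eq_abs] at h
    linarith
  · have hz' : ‖z - x‖ ≤ ‖y - x‖ := by simpa [dist_eq_norm] using hz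
    exact (convex_univ.norm_image_sub_le_of_norm_fderiv_le (𝕜 := ℝ) (fun w _ => hf' w)
      (fun w _ => hb w) (Set.mem_univ x) (Set.mem_univ z)).trans
      (mul_le_mul_of_nonneg_left hz' hC0)

lemma abs_sub_sub_inner_gradient_le [InnerProductSpace ℝ E] [CompleteSpace E]
    (hf : ContDiff ℝ 2 f) (hC : ∀ x, ‖iteratedFDeriv ℝ 2 f x‖ ≤ C) (x y : E) :
    |f y - f x - ⟪gradient f x, y - x⟫| ≤ C * ‖y - x‖ ^ 2 := by
  rw [inner_gradient_left]
  exact abs_sub_sub_fderiv_le_of_norm_iteratedFDeriv_two_le hf hC x y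

lemma ContDiff.continuous_gradient [InnerProductSpace ℝ E] [CompleteSpace E]
    (hf : ContDiff ℝ 2 f) : Continuous (gradient f) :=
  (InnerProductSpace.toDual ℝ E).symm.continuous.comp (hf.continuous_fderiv (by norm_num))

end Taylor

/-- A continuous function of a measurable, almost surely bounded variable is integrable. -/
lemma Continuous.integrable_comp_of_ae_norm_le {Ω E : Type*} [MeasurableSpace Ω]
    [NormedAddCommGroup E] [ProperSpace E] [MeasurableSpace E] [BorelSpace E]
    {μ : Measure Ω} [IsFiniteMeasure μ] {f : E → ℝ} (hf : Continuous f) {X : Ω → E}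
    (hX : Measurable X) {R : ℝ} (hR : ∀ᵐ ω ∂μ, ‖X ω‖ ≤ R) :
    Integrable (fun ω => f (X ω)) μ := by
  obtain ⟨M, hM⟩ := (isCompact_closedBall (0 : E) R).exists_bound_of_continuousOn hf.continuousOn
  refine Integrable.of_bound (hf.measurable.comp hX).aestronglyMeasurable M ?_
  filter_upwards [hR] with ω hω
  exact hM _ (by simpa using hω)


/-- **First-order regularization, case `p = ∞`** (Remark 2.2).
For the `W_∞` adversary, i.e. couplings `ν` with first marginal `μ₀` and
`N(x̃ − x) ≤ δ` for `ν`-a.e. `(x, x̃)`, the robust objective equals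
`∫ j dμ₀ + δ ∫ Nstar(∇_x j) dμ₀ + O(δ²)` uniformly in `θ`, with the constant in the `O(δ²)`
term depending only on the Hessian bound `C`, the dimension `d` and the norm `N`. -/
theorem stmt_2
    {d : ℕ} {Θ : Type*}
    (N Nstar : EuclideanSpace ℝ (Fin d) → ℝ)
    (hN0 : ∀ x, N x = 0 ↔ x = 0)
    (hNsmul : ∀ (a : ℝ) (x : EuclideanSpace ℝ (Fin d)), N (a • x) = |a| * N x)
    (hNadd : ∀ x y, N (x + y) ≤ N x + N y)
    (hNstar : ∀ y, Nstar y = sSup {r : ℝ | ∃ x, N x ≤ 1 ∧ r = ⟪y, x⟫})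
    (C : ℝ) :
    ∃ C' : ℝ,
      ∀ (μ₀ : Measure (EuclideanSpace ℝ (Fin d))), IsProbabilityMeasure μ₀ →
      (∃ K : Set (EuclideanSpace ℝ (Fin d)), Bornology.IsBounded K ∧ μ₀ Kᶜ = 0) →
      ∀ (j : EuclideanSpace ℝ (Fin d) → Θ → ℝ),
      (∀ θ, ContDiff ℝ 2 (fun x => j x θ)) →
      (∀ θ x, ‖iteratedFDeriv ℝ 2 (fun y => j y θ) x‖ ≤ C) →
      ∀ (θ : Θ) (δ : ℝ), 0 < δ →
      |sSup {r : ℝ |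
          ∃ ν : Measure (EuclideanSpace ℝ (Fin d) × EuclideanSpace ℝ (Fin d)),
            IsProbabilityMeasure ν ∧ ν.map Prod.fst = μ₀ ∧
            (∀ᵐ z ∂ν, N (z.2 - z.1) ≤ δ) ∧
            r = ∫ z, j z.2 θ ∂ν}
        - ∫ x, j x θ ∂μ₀
        - δ * ∫ x, Nstar (gradient (fun y => j y θ) x) ∂μ₀|
      ≤ C' * δ ^ 2 := by
  obtain ⟨B, hB, hNB⟩ := exists_norm_le_mul_of_isNorm hN0 hNsmul hNadd
  have hN00 : N 0 = 0 := (hN0 0).2 rfl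
  have hNstarc := continuous_dualNorm hB hNB hN00 hNstar
  refine ⟨C * B ^ 2 + 1, fun μ₀ hμ₀ hK j hj hjC θ δ hδ => ?_⟩
  obtain ⟨K, hKb, hK0⟩ := hK
  obtain ⟨R, hR⟩ := hKb.exists_norm_le
  have hμR : ∀ᵐ x ∂μ₀, ‖x‖ ≤ R := by
    filter_upwards [measure_eq_zero_iff_ae_notMem.1 hK0] with x hx
    exact hR x (not_not.1 hx)
  set f : EuclideanSpace ℝ (Fin d) → ℝ := fun x => j x θ
  have hC0 : 0 ≤ C := (norm_nonneg _).trans (hjC θ 0)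
  have hfc : Continuous f := (hj θ).continuous
  have hgc : Continuous (fun x => Nstar (gradient f x)) := hNstarc.comp (hj θ).continuous_gradient
  have hfi : Integrable f μ₀ := hfc.integrable_comp_of_ae_norm_le measurable_id hμR
  have hgi : Integrable (fun x => Nstar (gradient f x)) μ₀ :=
    hgc.integrable_comp_of_ae_norm_le measurable_id hμR
  have htaylor : ∀ x y, N (y - x) ≤ δ →
      |f y - f x - ⟪gradient f x, y - x⟫| ≤ C * B ^ 2 * δ ^ 2 := by
    intro x y hxy
    refine (abs_sub_sub_inner_gradient_le (hj θ) (hjC θ) x y).trans ?_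
    have h1 : ‖y - x‖ ≤ B * δ := (hNB _).trans (mul_le_mul_of_nonneg_left hxy hB.le)
    rw [mul_assoc, ← mul_pow]
    gcongr
  have hub : ∀ r ∈ {r : ℝ |
      ∃ ν : Measure (EuclideanSpace ℝ (Fin d) × EuclideanSpace ℝ (Fin d)),
        IsProbabilityMeasure ν ∧ ν.map Prod.fst = μ₀ ∧
        (∀ᵐ z ∂ν, N (z.2 - z.1) ≤ δ) ∧ r = ∫ z, f z.2 ∂ν},
      r ≤ ∫ x, f x ∂μ₀ + δ * ∫ x, Nstar (gradient f x) ∂μ₀ + C * B ^ 2 * δ ^ 2 := by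
    rintro r ⟨ν, hν, hmarg, hνδ, rfl⟩
    have hν1 : ∀ᵐ z ∂ν, ‖z.1‖ ≤ R :=
      ae_of_ae_map (p := fun x => ‖x‖ ≤ R) measurable_fst.aemeasurable (by rwa [hmarg])
    have hν2 : ∀ᵐ z ∂ν, ‖z.2‖ ≤ R + B * δ := by
      filter_upwards [hν1, hνδ] with z h1 h2
      have h3 : ‖z.2 - z.1‖ ≤ B * δ := (hNB _).trans (mul_le_mul_of_nonneg_left h2 hB.le)
      calc ‖z.2‖ = ‖z.1 + (z.2 - z.1)‖ := by rw [add_sub_cancel]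
        _ ≤ ‖z.1‖ + ‖z.2 - z.1‖ := norm_add_le _ _
        _ ≤ R + B * δ := add_le_add h1 h3
    have i1 := hfc.integrable_comp_of_ae_norm_le measurable_fst hν1
    have i2 := hfc.integrable_comp_of_ae_norm_le measurable_snd hν2
    have i3 := (hgc.integrable_comp_of_ae_norm_le measurable_fst hν1).const_mul δ
    have i4 : Integrable (fun z => f z.1 + δ * Nstar (gradient f z.1)) ν := i1.add i3
    have e1 : ∫ x, f x ∂μ₀ = ∫ z, f z.1 ∂ν := by
      rw [← hmarg]
      exact integral_map measurable_fst.aemeasurable hfc.aestronglyMeasurable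
    have e2 : ∫ x, Nstar (gradient f x) ∂μ₀ = ∫ z, Nstar (gradient f z.1) ∂ν := by
      rw [← hmarg]
      exact integral_map measurable_fst.aemeasurable hgc.aestronglyMeasurable
    calc ∫ z, f z.2 ∂ν
        ≤ ∫ z, (f z.1 + δ * Nstar (gradient f z.1) + C * B ^ 2 * δ ^ 2) ∂ν := by
          refine integral_mono_ae i2 (i4.add (integrable_const _)) ?_
          filter_upwards [hνδ] with z hz
          have h1 := (abs_le.1 (htaylor z.1 z.2 hz)).2
          have h2 := inner_le_mul_dualNorm hB hNB hNsmul hNstar hδ (gradient f z.1) hz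
          linarith
      _ = _ := by
          rw [integral_add i4 (integrable_const _), integral_add i1 i3,
            integral_const_mul, e1, e2]
          simp
  obtain ⟨T, hTm, hT⟩ := exists_measurable_dualNorm_sub_le_inner hN00 hNstarc hNstar hδ
  set S : EuclideanSpace ℝ (Fin d) → EuclideanSpace ℝ (Fin d) :=
    fun x => x + δ • T (gradient f x) with hS
  have hSm : Measurable S :=
    measurable_id.add ((hTm.comp (hj θ).continuous_gradient.measurable).const_smul δ)
  have hSδ : ∀ x, N (S x - x) ≤ δ := fun x => by
    rw [hS, add_sub_cancel_left, hNsmul, abs_of_pos hδ]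
    exact mul_le_of_le_one_right hδ.le (hT _).1
  have hpm : Measurable fun x => (x, S x) := measurable_id.prodMk hSm
  have hmem : ∫ x, f (S x) ∂μ₀ ∈ {r : ℝ |
      ∃ ν : Measure (EuclideanSpace ℝ (Fin d) × EuclideanSpace ℝ (Fin d)),
        IsProbabilityMeasure ν ∧ ν.map Prod.fst = μ₀ ∧
        (∀ᵐ z ∂ν, N (z.2 - z.1) ≤ δ) ∧ r = ∫ z, f z.2 ∂ν} := by
    refine ⟨μ₀.map fun x => (x, S x), Measure.isProbabilityMeasure_map hpm.aemeasurable, ?_, ?_, ?_⟩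
    · rw [Measure.map_map measurable_fst hpm]
      exact Measure.map_id
    · have hNc := continuous_of_homogeneous_of_subadditive hNsmul hNadd
      refine (ae_map_iff hpm.aemeasurable ?_).2 (Filter.Eventually.of_forall hSδ)
      exact (isClosed_le (hNc.comp (by fun_prop)) continuous_const).measurableSet
    · exact (integral_map hpm.aemeasurable
        (hfc.comp continuous_snd).aestronglyMeasurable).symm
  have hlow : ∫ x, f x ∂μ₀ + δ * ∫ x, Nstar (gradient f x) ∂μ₀ - (C * B ^ 2 + 1) * δ ^ 2
      ≤ ∫ x, f (S x) ∂μ₀ := by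
    have hSR : ∀ᵐ x ∂μ₀, ‖S x‖ ≤ R + B * δ := by
      filter_upwards [hμR] with x h1
      have h3 : ‖S x - x‖ ≤ B * δ := (hNB _).trans (mul_le_mul_of_nonneg_left (hSδ x) hB.le)
      calc ‖S x‖ = ‖x + (S x - x)‖ := by rw [add_sub_cancel]
        _ ≤ ‖x‖ + ‖S x - x‖ := norm_add_le _ _
        _ ≤ R + B * δ := add_le_add h1 h3
    have i3 := hgi.const_mul δ
    have i4 : Integrable (fun x => f x + δ * Nstar (gradient f x)) μ₀ := hfi.add i3
    calc _ = ∫ x, (f x + δ * Nstar (gradient f x) - (C * B ^ 2 + 1) * δ ^ 2) ∂μ₀ := by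
          rw [integral_sub i4 (integrable_const _), integral_add hfi i3,
            integral_const_mul]
          simp
      _ ≤ _ := by
          refine integral_mono (i4.sub (integrable_const _))
            (hfc.integrable_comp_of_ae_norm_le hSm hSR) fun x => ?_
          have h1 := (abs_le.1 (htaylor x (S x) (hSδ x))).1
          have h2 := mul_le_mul_of_nonneg_left (hT (gradient f x)).2 hδ.le
          have h3 : ⟪gradient f x, S x - x⟫ = δ * ⟪gradient f x, T (gradient f x)⟫ := by
            rw [hS, add_sub_cancel_left, real_inner_smul_right]
          dsimp only
          nlinarith
  have hle := csSup_le ⟨_, hmem⟩ hub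
  have hge := le_csSup ⟨_, hub⟩ hmem
  rw [abs_le]
  constructor
  · linarith
  · nlinarith [sq_nonneg δ]
end

section
/- Let T > 0, let A, Q : [0,T] → ℝ^{d×d} be continuous with Q(t) symmetric for every t, and let C be a symmetric d×d real matrix. Suppose γ, ρ, ζ, η : [0,T] → ℝ^d are differentiable and satisfy, for all t ∈ [0,T]: γ′(t) = A(t) γ(t); ρ′(t) = −A(t)ᵀ ρ(t) + Q(t) γ(t) with ρ(T) = C γ(T); ζ′(t) = A(t) ζ(t); and η′(t) = −A(t)ᵀ η(t) − Q(t) ζ(t) with η(T) = −C ζ(T). Then ⟨η(0), γ(0)⟩ = −⟨ρ(0), ζ(0)⟩. -/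
open MeasureTheory Matrix

theorem HasDerivAt.dotProduct {ι : Type*} [Fintype ι] {u v : ℝ → ι → ℝ} {u' v' : ι → ℝ} {t : ℝ}
    (hu : HasDerivAt u u' t) (hv : HasDerivAt v v' t) :
    HasDerivAt (fun s ↦ u s ⬝ᵥ v s) (u' ⬝ᵥ v t + u t ⬝ᵥ v') t := by
  simp only [_root_.dotProduct, ← Finset.sum_add_distrib]
  exact HasDerivAt.fun_sum fun i _ ↦ (hasDerivAt_pi.1 hu i).mul (hasDerivAt_pi.1 hv i)

theorem Matrix.mulVec_transpose_dotProduct {ι κ : Type*} [Fintype ι] [Fintype κ]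
    (M : Matrix ι κ ℝ) (u : ι → ℝ) (v : κ → ℝ) :
    Mᵀ.mulVec u ⬝ᵥ v = u ⬝ᵥ M.mulVec v := by
  rw [mulVec_transpose, dotProduct_mulVec]

theorem Matrix.IsSymm.mulVec_dotProduct {ι : Type*} [Fintype ι] {M : Matrix ι ι ℝ}
    (hM : M.IsSymm) (u v : ι → ℝ) : M.mulVec u ⬝ᵥ v = M.mulVec v ⬝ᵥ u := by
  rw [dotProduct_comm (M.mulVec v), ← mulVec_transpose_dotProduct, hM.eq]

/-- **Adjoint identity for the second-order problem** (Lemma 3.6): with `γ′ = Aγ`,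
`ρ′ = −Aᵀρ + Qγ`, `ρ(T) = Cγ(T)`, `ζ′ = Aζ`, `η′ = −Aᵀη − Qζ`, `η(T) = −Cζ(T)`,
where `Q(t)` and `C` are symmetric, one has `⟨η(0), γ(0)⟩ = −⟨ρ(0), ζ(0)⟩`. -/
theorem stmt_7 {d : ℕ} (T : ℝ) (hT : 0 < T)
    (A Q : ℝ → Matrix (Fin d) (Fin d) ℝ)
    (hA : ContinuousOn A (Set.Icc 0 T)) (hQ : ContinuousOn Q (Set.Icc 0 T))
    (hQsymm : ∀ t, (Q t).IsSymm)
    (C : Matrix (Fin d) (Fin d) ℝ) (hC : C.IsSymm)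
    (γ ρ ζ η : ℝ → Fin d → ℝ)
    (hγ : ∀ t ∈ Set.Icc (0:ℝ) T, HasDerivAt γ ((A t).mulVec (γ t)) t)
    (hρ : ∀ t ∈ Set.Icc (0:ℝ) T,
      HasDerivAt ρ (-((A t)ᵀ.mulVec (ρ t)) + (Q t).mulVec (γ t)) t)
    (hρT : ρ T = C.mulVec (γ T))
    (hζ : ∀ t ∈ Set.Icc (0:ℝ) T, HasDerivAt ζ ((A t).mulVec (ζ t)) t)
    (hη : ∀ t ∈ Set.Icc (0:ℝ) T,
      HasDerivAt η (-((A t)ᵀ.mulVec (η t)) - (Q t).mulVec (ζ t)) t)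
    (hηT : η T = -(C.mulVec (ζ T))) :
    η 0 ⬝ᵥ γ 0 = -(ρ 0 ⬝ᵥ ζ 0) := by
  have hderiv : ∀ t ∈ Set.Icc (0 : ℝ) T,
      HasDerivAt (fun s ↦ η s ⬝ᵥ γ s + ρ s ⬝ᵥ ζ s) 0 t := by
    intro t ht
    refine (((hη t ht).dotProduct (hγ t ht)).add
      ((hρ t ht).dotProduct (hζ t ht))).congr_deriv ?_
    simp only [sub_dotProduct, add_dotProduct, neg_dotProduct, mulVec_transpose_dotProduct,
      (hQsymm t).mulVec_dotProduct (ζ t) (γ t)]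
    ring
  have hconst := constant_of_has_deriv_right_zero
    (fun t ht ↦ (hderiv t ht).continuousAt.continuousWithinAt)
    (fun t ht ↦ (hderiv t (Set.Ico_subset_Icc_self ht)).hasDerivWithinAt)
    T (Set.right_mem_Icc.2 hT.le)
  have hend : η T ⬝ᵥ γ T + ρ T ⬝ᵥ ζ T = 0 := by
    rw [hηT, hρT, neg_dotProduct, hC.mulVec_dotProduct (ζ T) (γ T), neg_add_cancel]
  exact eq_neg_of_add_eq_zero_left (hconst.symm.trans hend)
end
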